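/- arXiv:2207.10366 — 3 statements merged into one kernel-verified Lean document; each statement's English description precedes it below -/
import Mathlib

section
/- Let n ≥ 2 and let A : ℝⁿ₊ → M_{m×m}(ℝ) be locally Lipschitz such that dμ⁰(x,t) = |∇_x A(x,t)|² t dx dt is a Carleson measure on ℝⁿ₊ with norm at most K, and |∇_x A(x,t)| ≤ K^{1/2}/t for all (x,t) ∈ ℝⁿ₊. For an integer k ≥ 2 define A^k(x,t) = A(x,kt) and dμ^k(x,t) = |∇_x A^k(x,t)|² t dx dt. Then there exists a constant C(n) > 0 such that μ^k is a Carleson measure with norm at most K(1 + C(n) log k)/k². -/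
open MeasureTheory Set Filter
open scoped ENNReal NNReal

noncomputable section

/-! ## Basic geometry of the upper half-space `ℝⁿ₊ = ℝ^{n-1} × (0,∞)` -/

abbrev EE (n : ℕ) := EuclideanSpace ℝ (Fin (n - 1))
abbrev Pt (n : ℕ) := EE n × ℝ

/-- The upper half-space `ℝⁿ₊`. -/
def UHS (n : ℕ) : Set (Pt n) := {X | 0 < X.2}

/-- Euclidean distance on `ℝ^{n-1} × ℝ`. -/
def dist2 {n : ℕ} (X Y : Pt n) : ℝ := Real.sqrt (dist X.1 Y.1 ^ 2 + (X.2 - Y.2) ^ 2)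

/-- Euclidean ball in `ℝ^{n-1} × ℝ`. -/
def ball2 {n : ℕ} (X : Pt n) (r : ℝ) : Set (Pt n) := {Y | dist2 Y X < r}

/-- Whitney ball `B(X, δ(X)/2)` for the upper half-space (`δ(X) = t`). -/
def wball {n : ℕ} (X : Pt n) : Set (Pt n) := ball2 X (X.2 / 2)

/-- Nontangential cone of aperture `a` with vertex `q ∈ ℝ^{n-1} = ∂ℝⁿ₊`. -/
def cone {n : ℕ} (a : ℝ) (q : EE n) : Set (Pt n) :=
  {X | 0 < X.2 ∧ dist2 X (q, 0) ≤ (1 + a) * X.2}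

/-- Cone truncated at height `h`. -/
def coneTrunc {n : ℕ} (a h : ℝ) (q : EE n) : Set (Pt n) := cone a q ∩ {X | X.2 < h}

/-- Doubly truncated cone `Γ_ε(q)`. -/
def coneEps {n : ℕ} (a ε : ℝ) (q : EE n) : Set (Pt n) :=
  cone a q ∩ {X | ε < X.2 ∧ X.2 < 1 / ε}

/-! ## Derivatives -/

/-- The `i`-th coordinate direction in `ℝ^{n-1} × ℝ`. -/
def bvec (n : ℕ) (i : Fin n) : Pt n :=
  if h : (i : ℕ) < n - 1 then (EuclideanSpace.single (⟨i, h⟩ : Fin (n - 1)) 1, 0)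
  else ((0 : EE n), 1)

/-- Partial derivative of `u` in the `i`-th coordinate direction. -/
def pd {n : ℕ} (i : Fin n) (u : Pt n → ℝ) (X : Pt n) : ℝ := fderiv ℝ u X (bvec n i)

/-- Horizontal partial derivative. -/
def pdx {n : ℕ} (i : Fin (n - 1)) (u : Pt n → ℝ) (X : Pt n) : ℝ :=
  fderiv ℝ u X (EuclideanSpace.single i 1, 0)

/-- Vertical partial derivative `∂_t`. -/
def pdt {n : ℕ} (u : Pt n → ℝ) (X : Pt n) : ℝ := fderiv ℝ u X (0, 1)

/-- Squared length of the full gradient of `u`. -/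
def gradSq {n : ℕ} (u : Pt n → ℝ) (X : Pt n) : ℝ := ∑ i : Fin n, pd i u X ^ 2

/-- Squared length of the horizontal gradient of `u`. -/
def gradxSq {n : ℕ} (u : Pt n → ℝ) (X : Pt n) : ℝ := ∑ i : Fin (n - 1), pdx i u X ^ 2

/-- Squared Hilbert–Schmidt norm of the Hessian of `u`. -/
def hessSq {n : ℕ} (u : Pt n → ℝ) (X : Pt n) : ℝ :=
  ∑ i : Fin n, ∑ j : Fin n, pd i (pd j u) X ^ 2

/-- Partial derivative of a function on the boundary `ℝ^{n-1}` (or `ℝ^d`). -/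
def pdE {d : ℕ} (i : Fin d) (f : EuclideanSpace ℝ (Fin d) → ℝ)
    (q : EuclideanSpace ℝ (Fin d)) : ℝ :=
  fderiv ℝ f q (EuclideanSpace.single i 1)

/-- Squared length of the gradient of a boundary function. -/
def gradSqE {d : ℕ} (f : EuclideanSpace ℝ (Fin d) → ℝ) (q : EuclideanSpace ℝ (Fin d)) : ℝ :=
  ∑ i, pdE i f q ^ 2

/-- Frobenius norm of an `m × m` matrix. -/
def mnorm {m : ℕ} (M : Fin m → Fin m → ℝ) : ℝ := Real.sqrt (∑ p, ∑ q, M p q ^ 2)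

/-- Norm of the full gradient of a matrix-valued function. -/
def gradA {n m : ℕ} (A : Pt n → Fin m → Fin m → ℝ) (X : Pt n) : ℝ :=
  Real.sqrt (∑ p, ∑ q, gradSq (fun Y => A Y p q) X)

/-- Norm of the horizontal gradient of a matrix-valued function. -/
def gradxA {n m : ℕ} (A : Pt n → Fin m → Fin m → ℝ) (X : Pt n) : ℝ :=
  Real.sqrt (∑ p, ∑ q, gradxSq (fun Y => A Y p q) X)

/-! ## Nontangential maximal functions, square functions, norms -/

/-- Nontangential maximal function. -/
def NT {n : ℕ} (a : ℝ) (F : Pt n → ℝ) (q : EE n) : ℝ≥0∞ :=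
  ⨆ X ∈ cone a q, ENNReal.ofReal |F X|

/-- Nontangential maximal function of a vector-valued function. -/
def NTv {n m : ℕ} (a : ℝ) (w : Fin m → Pt n → ℝ) (q : EE n) : ℝ≥0∞ :=
  ⨆ X ∈ cone a q, ENNReal.ofReal (Real.sqrt (∑ k, w k X ^ 2))

/-- `L²`-averaged nontangential maximal function `Ñ`, applied to the *squared*
density `G` (e.g. `G = |∇u|²`). -/
def NTav {n : ℕ} (a : ℝ) (G : Pt n → ℝ) (q : EE n) : ℝ≥0∞ :=
  ⨆ X ∈ cone a q,
    ((volume (wball X))⁻¹ * ∫⁻ Y in wball X, ENNReal.ofReal (G Y)) ^ (1 / 2 : ℝ)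

/-- Truncated version of `NTav` (cones truncated at height `h`). -/
def NTavTr {n : ℕ} (a h : ℝ) (G : Pt n → ℝ) (q : EE n) : ℝ≥0∞ :=
  ⨆ X ∈ coneTrunc a h q,
    ((volume (wball X))⁻¹ * ∫⁻ Y in wball X, ENNReal.ofReal (G Y)) ^ (1 / 2 : ℝ)

/-- `L¹`-averaged nontangential maximal function, over a general family `Γ` of points. -/
def NT1on {n : ℕ} (Γ : Set (Pt n)) (F : Pt n → ℝ) : ℝ≥0∞ :=
  ⨆ X ∈ Γ, (volume (wball X))⁻¹ * ∫⁻ Y in wball X, ENNReal.ofReal |F Y|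

/-- Square function over a region `Γ`, applied to the *squared* density `G = |∇v|²`. -/
def SFon {n : ℕ} (Γ : Set (Pt n)) (G : Pt n → ℝ) : ℝ≥0∞ :=
  (∫⁻ X in Γ, ENNReal.ofReal (G X) * ENNReal.ofReal (X.2 ^ ((2 : ℝ) - n))) ^ (1 / 2 : ℝ)

/-- Square function with aperture `a`, applied to the squared density `G = |∇v|²`. -/
def SF {n : ℕ} (a : ℝ) (G : Pt n → ℝ) (q : EE n) : ℝ≥0∞ := SFon (cone a q) G

/-- `L^p` (quasi-)norm over `ℝ^{n-1}` of an `ℝ≥0∞`-valued function. -/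
def bLp {d : ℕ} (p : ℝ) (g : EuclideanSpace ℝ (Fin d) → ℝ≥0∞) : ℝ≥0∞ :=
  (∫⁻ q, g q ^ p) ^ (1 / p)

/-- `L^p` (quasi-)norm over a subset `S ⊆ ℝ^{n-1}`. -/
def bLpOn {d : ℕ} (p : ℝ) (S : Set (EuclideanSpace ℝ (Fin d)))
    (g : EuclideanSpace ℝ (Fin d) → ℝ≥0∞) : ℝ≥0∞ :=
  (∫⁻ q in S, g q ^ p) ^ (1 / p)

/-- Localized Hardy–Littlewood maximal function, over balls contained in `R`. -/
def MHL {d : ℕ} (R : Set (EuclideanSpace ℝ (Fin d))) (g : EuclideanSpace ℝ (Fin d) → ℝ≥0∞)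
    (x : EuclideanSpace ℝ (Fin d)) : ℝ≥0∞ :=
  ⨆ (z : EuclideanSpace ℝ (Fin d)) (ρ : ℝ) (_ : 0 < ρ) (_ : x ∈ Metric.ball z ρ)
      (_ : Metric.ball z ρ ⊆ R),
    (volume (Metric.ball z ρ))⁻¹ * ∫⁻ y in Metric.ball z ρ, g y

/-! ## Carleson measures on the half-space -/

/-- `μ` is a Carleson measure on `ℝⁿ₊` with norm at most `K`. -/
def CarlNormLE {n : ℕ} (μ : Measure (Pt n)) (K : ℝ) : Prop :=
  ∀ (q : EE n) (r : ℝ), 0 < r →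
    μ (Metric.ball q r ×ˢ Ioo 0 r) ≤ ENNReal.ofReal K * volume (Metric.ball q r)

/-- `μ` is a Carleson measure on `ℝⁿ₊`. -/
def IsCarleson {n : ℕ} (μ : Measure (Pt n)) : Prop := ∃ K : ℝ, 0 ≤ K ∧ CarlNormLE μ K

/-- The measure with density `g` with respect to Lebesgue measure. -/
def densM {n : ℕ} (g : Pt n → ℝ≥0∞) : Measure (Pt n) := volume.withDensity g

/-! ## Ellipticity, weak solutions, solvability (half-space) -/

/-- Uniform ellipticity of an `m × m` matrix-valued function on `Ω`. -/
def EllipticOn {n m : ℕ} (Ω : Set (Pt n)) (A : Pt n → Fin m → Fin m → ℝ)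
    (lam Lam : ℝ) : Prop :=
  ∀ X ∈ Ω,
    (∀ ξ : Fin m → ℝ, lam * ∑ i, ξ i ^ 2 ≤ ∑ i, ∑ j, A X i j * ξ j * ξ i) ∧
    (∀ ξ η : Fin m → ℝ, |∑ i, ∑ j, A X i j * ξ j * η i| ≤
      Lam * Real.sqrt (∑ i, ξ i ^ 2) * Real.sqrt (∑ i, η i ^ 2))

/-- Smooth compactly supported test function with support in `Ω`. -/
def TestFun {n : ℕ} (Ω : Set (Pt n)) (ϕ : Pt n → ℝ) : Prop :=
  ContDiff ℝ (⊤ : ℕ∞) ϕ ∧ HasCompactSupport ϕ ∧ tsupport ϕ ⊆ Ω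

/-- Weak solution of `div(A∇u)=0` in `ℝⁿ₊`. -/
def WeakSolution {n : ℕ} (A : Pt n → Fin n → Fin n → ℝ) (u : Pt n → ℝ) : Prop :=
  (∀ X ∈ UHS n, DifferentiableAt ℝ u X) ∧
  ∀ ϕ : Pt n → ℝ, TestFun (UHS n) ϕ →
    (∫ X in UHS n, ∑ i, ∑ j, A X i j * pd j u X * pd i ϕ X) = 0

/-- Finite Dirichlet energy: `u ∈ Ẇ^{1,2}(ℝⁿ₊)`. -/
def FiniteEnergy {n : ℕ} (u : Pt n → ℝ) : Prop :=
  (∫⁻ X in UHS n, ENNReal.ofReal (gradSq u X)) < ⊤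

/-- `u` has (vertical nontangential) boundary trace `f`. -/
def HasTrace {n : ℕ} (u : Pt n → ℝ) (f : EE n → ℝ) : Prop :=
  ∀ q : EE n, Tendsto (fun t : ℝ => u (q, t)) (nhdsWithin 0 (Ioi 0)) (nhds (f q))

/-- Energy solution of the Dirichlet problem with data `f`. -/
def EnergySolution {n : ℕ} (A : Pt n → Fin n → Fin n → ℝ) (u : Pt n → ℝ)
    (f : EE n → ℝ) : Prop :=
  WeakSolution A u ∧ FiniteEnergy u ∧ HasTrace u f

/-- Solvability of the `L^p` Dirichlet problem in `ℝⁿ₊`. -/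
def DirichletSolvable {n : ℕ} (A : Pt n → Fin n → Fin n → ℝ) (p : ℝ) : Prop :=
  ∃ C : ℝ, 0 < C ∧ ∀ u f, EnergySolution A u f →
    bLp p (NT 1 u) ≤ ENNReal.ofReal C * bLp p (fun q => ENNReal.ofReal |f q|)

/-- Solvability of the `L^p` Regularity problem in `ℝⁿ₊`. -/
def RegularitySolvable {n : ℕ} (A : Pt n → Fin n → Fin n → ℝ) (p : ℝ) : Prop :=
  ∃ C : ℝ, 0 < C ∧ ∀ u f, EnergySolution A u f → (∀ q, DifferentiableAt ℝ f q) →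
    bLp p (NTav 1 (gradSq u)) ≤
      ENNReal.ofReal C * bLp p (fun q => ENNReal.ofReal (gradSqE f q) ^ (1 / 2 : ℝ))

/-- The `n × n` block matrix built from an `(n-1) × (n-1)` matrix `A_∥`. -/
def blockOf {n : ℕ} (Apar : Pt n → Fin (n - 1) → Fin (n - 1) → ℝ) (X : Pt n)
    (i j : Fin n) : ℝ :=
  if h : (i : ℕ) < n - 1 ∧ (j : ℕ) < n - 1 then Apar X ⟨i, h.1⟩ ⟨j, h.2⟩
  else if (i : ℕ) = (j : ℕ) then 1 else 0

/-- The upper-left `(n-1) × (n-1)` block `A_∥` of an `n × n` matrix. -/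
def parOf {n : ℕ} (A : Pt n → Fin n → Fin n → ℝ) (X : Pt n)
    (i j : Fin (n - 1)) : ℝ :=
  A X (Fin.castLE (Nat.sub_le n 1) i) (Fin.castLE (Nat.sub_le n 1) j)

/-- Transpose of a matrix-valued function. -/
def transp {n m : ℕ} (A : Pt n → Fin m → Fin m → ℝ) : Pt n → Fin m → Fin m → ℝ :=
  fun X i j => A X j i

/-! ## Lipschitz graph domains -/

/-- The domain above the graph of `φ`. -/
def gdom {n : ℕ} (φ : EE n → ℝ) : Set (Pt n) := {X | φ X.1 < X.2}

/-- Distance to the boundary (the graph of `φ`). -/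
def gdist {n : ℕ} (φ : EE n → ℝ) (X : Pt n) : ℝ := ⨅ q : EE n, dist2 X (q, φ q)

/-- Whitney ball in a graph domain. -/
def gwball {n : ℕ} (φ : EE n → ℝ) (X : Pt n) : Set (Pt n) := ball2 X (gdist φ X / 2)

/-- Nontangential cone at the boundary point `(q, φ q)`. -/
def gcone {n : ℕ} (φ : EE n → ℝ) (a : ℝ) (q : EE n) : Set (Pt n) :=
  {X | X ∈ gdom φ ∧ dist2 X (q, φ q) ≤ (1 + a) * gdist φ X}

/-- Truncated cone in a graph domain. -/
def gconeTrunc {n : ℕ} (φ : EE n → ℝ) (a h : ℝ) (q : EE n) : Set (Pt n) :=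
  gcone φ a q ∩ {X | dist2 X (q, φ q) < h}

/-- Nontangential maximal function in a graph domain. -/
def gNT {n : ℕ} (φ : EE n → ℝ) (a : ℝ) (F : Pt n → ℝ) (q : EE n) : ℝ≥0∞ :=
  ⨆ X ∈ gcone φ a q, ENNReal.ofReal |F X|

/-- Truncated nontangential maximal function of a vector-valued function. -/
def gNTvTr {n m : ℕ} (φ : EE n → ℝ) (a h : ℝ) (w : Fin m → Pt n → ℝ) (q : EE n) : ℝ≥0∞ :=
  ⨆ X ∈ gconeTrunc φ a h q, ENNReal.ofReal (Real.sqrt (∑ k, w k X ^ 2))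

/-- `L²`-averaged nontangential maximal function in a graph domain,
applied to the squared density `G`. -/
def gNTav {n : ℕ} (φ : EE n → ℝ) (a : ℝ) (G : Pt n → ℝ) (q : EE n) : ℝ≥0∞ :=
  ⨆ X ∈ gcone φ a q,
    ((volume (gwball φ X))⁻¹ * ∫⁻ Y in gwball φ X, ENNReal.ofReal (G Y)) ^ (1 / 2 : ℝ)

/-- Square function over a region in a graph domain (squared density `G`). -/
def gSFon {n : ℕ} (φ : EE n → ℝ) (Γ : Set (Pt n)) (G : Pt n → ℝ) : ℝ≥0∞ :=
  (∫⁻ X in Γ, ENNReal.ofReal (G X) * ENNReal.ofReal (gdist φ X ^ ((2 : ℝ) - n))) ^ (1 / 2 : ℝ)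

/-- Carleson measure condition in a graph domain (surface measure of a boundary
ball of radius `r` is comparable to `r^{n-1}`). -/
def gCarlNormLE {n : ℕ} (φ : EE n → ℝ) (μ : Measure (Pt n)) (K : ℝ) : Prop :=
  ∀ (q : EE n) (r : ℝ), 0 < r →
    μ (ball2 (q, φ q) r ∩ gdom φ) ≤ ENNReal.ofReal (K * r ^ (n - 1))

def gIsCarleson {n : ℕ} (φ : EE n → ℝ) (μ : Measure (Pt n)) : Prop :=
  ∃ K : ℝ, 0 ≤ K ∧ gCarlNormLE φ μ K

/-- The density of the oscillation Carleson measure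
`δ(X)^{-1} [sup_{Y,Z ∈ B(X,δ(X)/2)} |A(Y) - A(Z)|]²`. -/
def oscDens {n : ℕ} (φ : EE n → ℝ) (A : Pt n → Fin n → Fin n → ℝ) (X : Pt n) : ℝ≥0∞ :=
  (ENNReal.ofReal (gdist φ X))⁻¹ *
    (⨆ Y ∈ gwball φ X, ⨆ Z ∈ gwball φ X,
        ENNReal.ofReal (mnorm fun p q => A Y p q - A Z p q)) ^ 2

/-- `u` has boundary trace `f` on the graph (vertical nontangential limits). -/
def gHasTrace {n : ℕ} (φ : EE n → ℝ) (u : Pt n → ℝ) (f : EE n → ℝ) : Prop :=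
  ∀ q : EE n, Tendsto (fun t : ℝ => u (q, φ q + t)) (nhdsWithin 0 (Ioi 0)) (nhds (f q))

/-- Weak solution of `div(A∇u)=0` in the graph domain. -/
def gWeakSolution {n : ℕ} (φ : EE n → ℝ) (A : Pt n → Fin n → Fin n → ℝ)
    (u : Pt n → ℝ) : Prop :=
  (∀ X ∈ gdom φ, DifferentiableAt ℝ u X) ∧
  ∀ ϕ : Pt n → ℝ, TestFun (gdom φ) ϕ →
    (∫ X in gdom φ, ∑ i, ∑ j, A X i j * pd j u X * pd i ϕ X) = 0

def gFiniteEnergy {n : ℕ} (φ : EE n → ℝ) (u : Pt n → ℝ) : Prop :=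
  (∫⁻ X in gdom φ, ENNReal.ofReal (gradSq u X)) < ⊤

def gEnergySolution {n : ℕ} (φ : EE n → ℝ) (A : Pt n → Fin n → Fin n → ℝ)
    (u : Pt n → ℝ) (f : EE n → ℝ) : Prop :=
  gWeakSolution φ A u ∧ gFiniteEnergy φ u ∧ gHasTrace φ u f

/-- Solvability of the `L^p` Dirichlet problem in the graph domain. -/
def gDirichletSolvable {n : ℕ} (φ : EE n → ℝ) (A : Pt n → Fin n → Fin n → ℝ)
    (p : ℝ) : Prop :=
  ∃ C : ℝ, 0 < C ∧ ∀ u f, gEnergySolution φ A u f →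
    bLp p (gNT φ 1 u) ≤ ENNReal.ofReal C * bLp p (fun q => ENNReal.ofReal |f q|)

/-- Solvability of the `L^p` Regularity problem in the graph domain; the boundary
datum is identified with a function `f` of `x ∈ ℝ^{n-1}`, and `∇_T f` with `∇_x f`. -/
def gRegularitySolvable {n : ℕ} (φ : EE n → ℝ) (A : Pt n → Fin n → Fin n → ℝ)
    (p : ℝ) : Prop :=
  ∃ C : ℝ, 0 < C ∧ ∀ u f, gEnergySolution φ A u f → (∀ q, DifferentiableAt ℝ f q) →
    bLp p (gNTav φ 1 (gradSq u)) ≤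
      ENNReal.ofReal C * bLp p (fun q => ENNReal.ofReal (gradSqE f q) ^ (1 / 2 : ℝ))

/-- Solvability of the `L^p` Neumann problem in the graph domain. The co-normal
data `f` is identified with a function of `x ∈ ℝ^{n-1}`. -/
def gNeumannSolvable {n : ℕ} (φ : EE n → ℝ) (A : Pt n → Fin n → Fin n → ℝ)
    (p : ℝ) : Prop :=
  ∃ C : ℝ, 0 < C ∧ ∀ (u : Pt n → ℝ) (f : EE n → ℝ),
    (∀ X ∈ gdom φ, DifferentiableAt ℝ u X) → gFiniteEnergy φ u →
    Integrable f → (∫ q, f q) = 0 →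
    (∀ η : Pt n → ℝ, ContDiff ℝ (⊤ : ℕ∞) η → HasCompactSupport η →
      (∫ X in gdom φ, ∑ i, ∑ j, A X i j * pd j u X * pd i η X) = ∫ q, f q * η (q, φ q)) →
    bLp p (gNTav φ 1 (gradSq u)) ≤ ENNReal.ofReal C * bLp p (fun q => ENNReal.ofReal |f q|)

/-! ## The weakly coupled system of Section 5 -/

/-- The common setup for the weakly coupled system: `B_∥` satisfies the Carleson
condition with constant `M`, the `v_m` are energy solutions of the block-form
operator with data `∂_m f`, and `η` solves the weakly coupled system with zero
boundary data. -/
def WCSetup {n : ℕ} (Bpar : Pt n → Fin (n - 1) → Fin (n - 1) → ℝ) (M : ℝ)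
    (f : EE n → ℝ) (v η : Fin (n - 1) → Pt n → ℝ) : Prop :=
  LocallyLipschitz Bpar ∧
  CarlNormLE (densM fun X => ENNReal.ofReal (gradxA Bpar X ^ 2 * X.2)) M ∧
  (∀ X ∈ UHS n, (X.2 * gradxA Bpar X) ^ 2 ≤ M) ∧
  (∫⁻ q, ENNReal.ofReal (gradSqE f q)) < ⊤ ∧
  (∀ q, DifferentiableAt ℝ f q) ∧
  (∀ m : Fin (n - 1), EnergySolution (blockOf Bpar) (v m) (fun q => pdE m f q)) ∧
  (∀ m : Fin (n - 1),
    (∀ X ∈ UHS n, DifferentiableAt ℝ (η m) X) ∧ FiniteEnergy (η m) ∧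
    HasTrace (η m) (fun _ => 0) ∧
    ∀ ϕ : Pt n → ℝ, TestFun (UHS n) ϕ →
      (∫ X in UHS n, (∑ i : Fin (n - 1), ∑ j : Fin (n - 1),
          Bpar X i j * pdx j (η m) X * pdx i ϕ X) + pdt (η m) X * pdt ϕ X) =
        -∫ X in UHS n, ∑ i : Fin (n - 1), ∑ j : Fin (n - 1),
            pdx m (fun Z => Bpar Z i j) X * (v j X + η j X) * pdx i ϕ X)


/-- The scaling `(x,t) ↦ (x,kt)` as a continuous linear equivalence. -/
def scaleEquiv (n : ℕ) (k : ℝ) (hk : k ≠ 0) : Pt n ≃L[ℝ] Pt n :=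
  (ContinuousLinearEquiv.refl ℝ (EE n)).prodCongr
    (ContinuousLinearEquiv.unitsEquivAut ℝ (Units.mk0 k hk))

lemma scaleEquiv_apply (n : ℕ) (k : ℝ) (hk : k ≠ 0) (X : Pt n) :
    scaleEquiv n k hk X = (X.1, k * X.2) := by
  simp [scaleEquiv, mul_comm]

lemma gradxA_scale {n m : ℕ} (A : Pt n → Fin m → Fin m → ℝ) (k : ℝ) (hk : k ≠ 0) (X : Pt n) :
    gradxA (fun Y (p q : Fin m) => A (Y.1, k * Y.2) p q) X = gradxA A (X.1, k * X.2) := by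
  unfold gradxA gradxSq pdx
  have key : ∀ (p q : Fin m) (v : EE n),
      fderiv ℝ (fun Y : Pt n => A (Y.1, k * Y.2) p q) X (v, 0)
        = fderiv ℝ (fun Y => A Y p q) (X.1, k * X.2) (v, 0) := by
    intro p q v
    have h := (scaleEquiv n k hk).comp_right_fderiv (f := fun Y => A Y p q) (x := X)
    have e : ((fun Y => A Y p q) ∘ (scaleEquiv n k hk)) =
        (fun Y : Pt n => A (Y.1, k * Y.2) p q) := by
      funext Y; simp [scaleEquiv_apply]
    rw [e] at h
    rw [h, scaleEquiv_apply]
    simp [scaleEquiv_apply]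
  simp only [key]

lemma map_scale (n : ℕ) (k : ℝ) (hk : 0 < k) :
    Measure.map (fun X : Pt n => (X.1, k * X.2)) volume
      = ENNReal.ofReal k⁻¹ • (volume : Measure (Pt n)) := by
  have h := Measure.map_prod_map (volume : Measure (EE n)) (volume : Measure ℝ)
    (f := id) (g := fun t => k * t) measurable_id (measurable_const_mul k)
  rw [Real.map_volume_mul_left hk.ne', Measure.map_id, Measure.prod_smul_right,
    abs_of_pos (inv_pos.2 hk)] at h
  exact h.symm

lemma lintegral_inv_piece (K r : ℝ) (k : ℝ) (hK : 0 ≤ K) (hr : 0 < r) (hk : 1 ≤ k) :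
    ∫⁻ t in Ico r (k * r), ENNReal.ofReal (K / t) = ENNReal.ofReal (K * Real.log k) := by
  have hle : r ≤ k * r := by nlinarith
  have hint : IntervalIntegrable (fun t : ℝ => K / t) volume r (k * r) := by
    apply ContinuousOn.intervalIntegrable
    rw [uIcc_of_le hle]
    exact continuousOn_const.div continuousOn_id (fun t ht => (hr.trans_le ht.1).ne')
  have hi := (intervalIntegrable_iff_integrableOn_Ioc_of_le hle).1 hint
  rw [setLIntegral_congr Ico_ae_eq_Ioc, ← ofReal_integral_eq_lintegral_ofReal hi,
    ← intervalIntegral.integral_of_le hle]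
  · congr 1
    simp only [div_eq_mul_inv]
    rw [intervalIntegral.integral_const_mul, integral_inv_of_pos hr (by nlinarith),
      mul_div_assoc, div_self hr.ne', mul_one]
  · filter_upwards [ae_restrict_mem measurableSet_Ioc] with t ht
    exact div_nonneg hK (hr.trans ht.1).le

/-- **estimate (5.7) of the paper.** Rescaling in `t` shrinks the
horizontal-gradient Carleson norm: if `|∇_x A|² t` is Carleson with norm `≤ K` and
`|∇_x A| ≤ K^{1/2}/t`, then for `A^k(x,t) = A(x,kt)` the measure `|∇_x A^k|² t`
is Carleson with norm at most `K(1 + C(n) log k)/k²`. -/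
theorem rescaled_carleson_norm (n : ℕ) (hn : 2 ≤ n) :
    ∃ C : ℝ, 0 < C ∧
      ∀ (m : ℕ) (A : Pt n → Fin m → Fin m → ℝ) (K : ℝ), 0 ≤ K →
        LocallyLipschitz A →
        CarlNormLE (densM fun X => ENNReal.ofReal (gradxA A X ^ 2 * X.2)) K →
        (∀ X ∈ UHS n, gradxA A X ≤ Real.sqrt K / X.2) →
        ∀ k : ℕ, 2 ≤ k →
          CarlNormLE
            (densM fun X => ENNReal.ofReal
              (gradxA (fun Y (p q : Fin m) => A (Y.1, (k : ℝ) * Y.2) p q) X ^ 2 * X.2))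
            (K * (1 + C * Real.log k) / k ^ 2) := by
  refine ⟨1, one_pos, ?_⟩
  intro m A K hK _ hC hG k hk2 q r hr
  have hk : (1 : ℝ) ≤ k := by exact_mod_cast (by omega : 1 ≤ k)
  have hk0 : (0 : ℝ) < k := by linarith
  have hlog : 0 ≤ Real.log k := Real.log_nonneg hk
  have h0 := hC q r hr
  have hmS : MeasurableSet (Metric.ball q r ×ˢ Ioo 0 r) :=
    Metric.isOpen_ball.measurableSet.prod measurableSet_Ioo
  unfold densM at h0 ⊢
  rw [withDensity_apply _ hmS] at h0 ⊢
  simp only [gradxA_scale A (k : ℝ) hk0.ne']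
  set H : Pt n → ℝ≥0∞ := fun X => ENNReal.ofReal (gradxA A X ^ 2 * X.2) with hH
  set T : Set (Pt n) := Metric.ball q r ×ˢ Ioo 0 (k * r) with hT
  have hmT : MeasurableSet T := Metric.isOpen_ball.measurableSet.prod measurableSet_Ioo
  have hcoe : ⇑(scaleEquiv n k hk0.ne').toHomeomorph.toMeasurableEquiv
      = fun X : Pt n => (X.1, (k : ℝ) * X.2) := by
    funext X; exact scaleEquiv_apply n k hk0.ne' X
  have hchange : ∫⁻ X in Metric.ball q r ×ˢ Ioo 0 r,
      ENNReal.ofReal (gradxA A (X.1, (k : ℝ) * X.2) ^ 2 * X.2)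
      = ENNReal.ofReal (((k : ℝ) ^ 2)⁻¹) * ∫⁻ X in T, H X := by
    have e1 : ∀ X : Pt n, ENNReal.ofReal (gradxA A (X.1, (k : ℝ) * X.2) ^ 2 * X.2)
        = ENNReal.ofReal ((k : ℝ)⁻¹) * H (X.1, (k : ℝ) * X.2) := by
      intro X
      rw [hH, ← ENNReal.ofReal_mul (by positivity)]
      congr 1
      field_simp
    have e2 : Metric.ball q r ×ˢ Ioo 0 r
        = (fun X : Pt n => (X.1, (k : ℝ) * X.2)) ⁻¹' T := by
      ext X
      simp [hT, hk0]
    simp only [e1]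
    rw [lintegral_const_mul' _ _ ENNReal.ofReal_ne_top, e2]
    have e3 : ∫⁻ X in (fun X : Pt n => (X.1, (k : ℝ) * X.2)) ⁻¹' T, H (X.1, (k : ℝ) * X.2)
        = ∫⁻ X in T, H X ∂(Measure.map (fun X : Pt n => (X.1, (k : ℝ) * X.2)) volume) := by
      have := (scaleEquiv n k hk0.ne').toHomeomorph.toMeasurableEquiv.measurableEmbedding.restrict_map
        (volume : Measure (Pt n)) T
      rw [hcoe] at this
      rw [this]
      have h2 := lintegral_map_equiv (μ := volume.restrict ((fun X : Pt n => (X.1, (k : ℝ) * X.2)) ⁻¹' T))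
        H (scaleEquiv n k hk0.ne').toHomeomorph.toMeasurableEquiv
      rw [hcoe] at h2
      exact h2.symm
    rw [e3, map_scale n k hk0, Measure.restrict_smul, lintegral_smul_measure, smul_eq_mul,
      ← mul_assoc, ← ENNReal.ofReal_mul (by positivity)]
    congr 2
    rw [sq, mul_inv]
  rw [hchange]
  have hsub : T ⊆ (Metric.ball q r ×ˢ Ioo 0 r) ∪ (Metric.ball q r ×ˢ Ico r (k * r)) := by
    rintro X ⟨hx, ht⟩
    rcases lt_or_ge X.2 r with h | h
    · exact Or.inl ⟨hx, ht.1, h⟩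
    · exact Or.inr ⟨hx, h, ht.2⟩
  have hmU : MeasurableSet (Metric.ball q r ×ˢ Ico r (k * r)) :=
    Metric.isOpen_ball.measurableSet.prod measurableSet_Ico
  have h1 : ∫⁻ X in Metric.ball q r ×ˢ Ico r (k * r), H X
      ≤ ENNReal.ofReal (K * Real.log k) * volume (Metric.ball q r) := by
    calc ∫⁻ X in Metric.ball q r ×ˢ Ico r (k * r), H X
        ≤ ∫⁻ X in Metric.ball q r ×ˢ Ico r (k * r), ENNReal.ofReal (K / X.2) := by
          refine setLIntegral_mono' hmU ?_
          intro X hX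
          have hX2 : 0 < X.2 := hr.trans_le hX.2.1
          refine ENNReal.ofReal_le_ofReal ?_
          have hb := hG X hX2
          have hg0 : 0 ≤ gradxA A X := Real.sqrt_nonneg _
          have : gradxA A X ^ 2 ≤ (Real.sqrt K / X.2) ^ 2 := by gcongr
          calc gradxA A X ^ 2 * X.2 ≤ (Real.sqrt K / X.2) ^ 2 * X.2 := by gcongr
            _ = K / X.2 := by rw [div_pow, Real.sq_sqrt hK]; field_simp
      _ = ENNReal.ofReal (K * Real.log k) * volume (Metric.ball q r) := by
          rw [Measure.volume_eq_prod, ← Measure.prod_restrict, lintegral_prod _ (by fun_prop)]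
          simp only [lintegral_inv_piece K r k hK hr hk]
          simp
  calc ENNReal.ofReal (((k : ℝ) ^ 2)⁻¹) * ∫⁻ X in T, H X
      ≤ ENNReal.ofReal (((k : ℝ) ^ 2)⁻¹) * (ENNReal.ofReal K * volume (Metric.ball q r)
          + ENNReal.ofReal (K * Real.log k) * volume (Metric.ball q r)) := by
        gcongr
        exact (lintegral_mono_set hsub).trans
          ((lintegral_union_le _ _ _).trans (add_le_add h0 h1))
    _ = ENNReal.ofReal (K * (1 + 1 * Real.log k) / k ^ 2) * volume (Metric.ball q r) := by
        rw [← add_mul, ← ENNReal.ofReal_add hK (by positivity), ← mul_assoc,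
          ← ENNReal.ofReal_mul (by positivity)]
        congr 2
        field_simp

end
end

section
/- Let Ω ⊆ ℝ² be open, let A : Ω → M_{2×2}(ℝ) be C¹ with det A(X) ≠ 0 for all X ∈ Ω, and let J = [[0,−1],[1,0]] (rotation by π/2). Suppose u, ũ ∈ C²(Ω) satisfy J∇ũ = A∇u on Ω, i.e. (−∂₂ũ, ∂₁ũ) = A∇u. Then: (i) div(A∇u) = 0 on Ω; (ii) with Ã = Aᵀ/det A one has the pointwise identity Ã∇ũ = −J∇u on Ω, and consequently div(Ã∇ũ) = 0 on Ω. -/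
open MeasureTheory Set Filter
open scoped ENNReal NNReal

noncomputable section

/-- Symmetry of second derivatives for a `C²` function on an open set, in the form
`∂₂∂₁ w = ∂₁∂₂ w`. -/
theorem kr_mixed (Ω : Set (ℝ × ℝ)) (hΩ : IsOpen Ω) (w : ℝ × ℝ → ℝ)
    (hw : ContDiffOn ℝ 2 w Ω) (X : ℝ × ℝ) (hX : X ∈ Ω) (a b : ℝ × ℝ) :
    fderiv ℝ (fun Y => fderiv ℝ w Y a) X b = fderiv ℝ (fun Y => fderiv ℝ w Y b) X a := by
  have hc : ContDiffAt ℝ 2 w X := hw.contDiffAt (hΩ.mem_nhds hX)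
  have hs : IsSymmSndFDerivAt ℝ w X := hc.isSymmSndFDerivAt (by simp)
  have hd : DifferentiableAt ℝ (fderiv ℝ w) X :=
    (hc.fderiv_right (m := 1) (by norm_num)).differentiableAt (by norm_num)
  rw [fderiv_clm_apply hd (differentiableAt_const a),
    fderiv_clm_apply hd (differentiableAt_const b)]
  simpa using hs b a

/-- **the Kenig–Rule conjugate.** If `J∇ũ = A∇u` on an open set
`Ω ⊆ ℝ²` (with `J` the rotation by `π/2`), then `div(A∇u) = 0`, the conjugate
relation `(Aᵀ/det A)∇ũ = -J∇u` holds pointwise, and `div((Aᵀ/det A)∇ũ) = 0`. -/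
theorem kenig_rule_conjugate (Ω : Set (ℝ × ℝ)) (hΩ : IsOpen Ω)
    (A : ℝ × ℝ → Fin 2 → Fin 2 → ℝ) (u v : ℝ × ℝ → ℝ)
    (hA : ContDiffOn ℝ 1 A Ω)
    (hdet : ∀ X ∈ Ω, A X 0 0 * A X 1 1 - A X 0 1 * A X 1 0 ≠ 0)
    (hu : ContDiffOn ℝ 2 u Ω) (hv : ContDiffOn ℝ 2 v Ω)
    (hrel : ∀ X ∈ Ω,
      -fderiv ℝ v X (0, 1) =
          A X 0 0 * fderiv ℝ u X (1, 0) + A X 0 1 * fderiv ℝ u X (0, 1) ∧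
      fderiv ℝ v X (1, 0) =
          A X 1 0 * fderiv ℝ u X (1, 0) + A X 1 1 * fderiv ℝ u X (0, 1)) :
    (∀ X ∈ Ω,
      fderiv ℝ (fun Y => A Y 0 0 * fderiv ℝ u Y (1, 0) +
        A Y 0 1 * fderiv ℝ u Y (0, 1)) X (1, 0) +
      fderiv ℝ (fun Y => A Y 1 0 * fderiv ℝ u Y (1, 0) +
        A Y 1 1 * fderiv ℝ u Y (0, 1)) X (0, 1) = 0) ∧
    (∀ X ∈ Ω,
      (A X 0 0 / (A X 0 0 * A X 1 1 - A X 0 1 * A X 1 0)) * fderiv ℝ v X (1, 0) +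
        (A X 1 0 / (A X 0 0 * A X 1 1 - A X 0 1 * A X 1 0)) * fderiv ℝ v X (0, 1) =
          fderiv ℝ u X (0, 1) ∧
      (A X 0 1 / (A X 0 0 * A X 1 1 - A X 0 1 * A X 1 0)) * fderiv ℝ v X (1, 0) +
        (A X 1 1 / (A X 0 0 * A X 1 1 - A X 0 1 * A X 1 0)) * fderiv ℝ v X (0, 1) =
          -fderiv ℝ u X (1, 0)) ∧
    (∀ X ∈ Ω,
      fderiv ℝ (fun Y =>
        (A Y 0 0 * fderiv ℝ v Y (1, 0) + A Y 1 0 * fderiv ℝ v Y (0, 1)) /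
          (A Y 0 0 * A Y 1 1 - A Y 0 1 * A Y 1 0)) X (1, 0) +
      fderiv ℝ (fun Y =>
        (A Y 0 1 * fderiv ℝ v Y (1, 0) + A Y 1 1 * fderiv ℝ v Y (0, 1)) /
          (A Y 0 0 * A Y 1 1 - A Y 0 1 * A Y 1 0)) X (0, 1) = 0) := by
  have key : ∀ X ∈ Ω,
      (A X 0 0 * fderiv ℝ v X (1, 0) + A X 1 0 * fderiv ℝ v X (0, 1)) /
          (A X 0 0 * A X 1 1 - A X 0 1 * A X 1 0) = fderiv ℝ u X (0, 1) ∧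
      (A X 0 1 * fderiv ℝ v X (1, 0) + A X 1 1 * fderiv ℝ v X (0, 1)) /
          (A X 0 0 * A X 1 1 - A X 0 1 * A X 1 0) = -fderiv ℝ u X (1, 0) := by
    intro X hX
    obtain ⟨h1, h2⟩ := hrel X hX
    have hd := hdet X hX
    constructor
    · rw [div_eq_iff hd]
      linear_combination A X 0 0 * h2 - A X 1 0 * h1
    · rw [div_eq_iff hd]
      linear_combination A X 0 1 * h2 - A X 1 1 * h1
  refine ⟨?_, ?_, ?_⟩
  · intro X hX
    have e1 : (fun Y => A Y 0 0 * fderiv ℝ u Y (1, 0) + A Y 0 1 * fderiv ℝ u Y (0, 1))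
        =ᶠ[nhds X] fun Y => -fderiv ℝ v Y (0, 1) := by
      filter_upwards [hΩ.mem_nhds hX] with Y hY using (hrel Y hY).1.symm
    have e2 : (fun Y => A Y 1 0 * fderiv ℝ u Y (1, 0) + A Y 1 1 * fderiv ℝ u Y (0, 1))
        =ᶠ[nhds X] fun Y => fderiv ℝ v Y (1, 0) := by
      filter_upwards [hΩ.mem_nhds hX] with Y hY using (hrel Y hY).2.symm
    rw [e1.fderiv_eq, e2.fderiv_eq, fderiv_fun_neg, ContinuousLinearMap.neg_apply,
      kr_mixed Ω hΩ v hv X hX (1, 0) (0, 1)]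
    ring
  · intro X hX
    obtain ⟨h1, h2⟩ := key X hX
    rw [← h1, ← h2]
    constructor <;> ring
  · intro X hX
    have e1 : (fun Y => (A Y 0 0 * fderiv ℝ v Y (1, 0) + A Y 1 0 * fderiv ℝ v Y (0, 1)) /
          (A Y 0 0 * A Y 1 1 - A Y 0 1 * A Y 1 0))
        =ᶠ[nhds X] fun Y => fderiv ℝ u Y (0, 1) := by
      filter_upwards [hΩ.mem_nhds hX] with Y hY using (key Y hY).1
    have e2 : (fun Y => (A Y 0 1 * fderiv ℝ v Y (1, 0) + A Y 1 1 * fderiv ℝ v Y (0, 1)) /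
          (A Y 0 0 * A Y 1 1 - A Y 0 1 * A Y 1 0))
        =ᶠ[nhds X] fun Y => -fderiv ℝ u Y (1, 0) := by
      filter_upwards [hΩ.mem_nhds hX] with Y hY using (key Y hY).2
    rw [e1.fderiv_eq, e2.fderiv_eq, fderiv_fun_neg, ContinuousLinearMap.neg_apply,
      kr_mixed Ω hΩ u hu X hX (1, 0) (0, 1)]
    ring

end
end

section
/- Let A ∈ M_{2×2}(ℝ) satisfy ⟨Aξ,ξ⟩ ≥ λ|ξ|² for all ξ ∈ ℝ² and |⟨Aξ,η⟩| ≤ Λ|ξ||η| for all ξ,η ∈ ℝ², where 0 < λ ≤ Λ. Then λ² ≤ det A ≤ Λ², and the matrix Ã = Aᵀ/det A satisfies ⟨Ãξ,ξ⟩ ≥ (λ/Λ²)|ξ|² for all ξ ∈ ℝ² and |⟨Ãξ,η⟩| ≤ (Λ/λ²)|ξ||η| for all ξ,η ∈ ℝ². -/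
open MeasureTheory Set Filter
open scoped ENNReal NNReal

noncomputable section

/-- Ellipticity of the conjugate matrix `Ã = Aᵀ/det A` for a
(possibly nonsymmetric) elliptic `2 × 2` matrix: `λ² ≤ det A ≤ Λ²`, `Ã` is
elliptic with constants `λ/Λ²` and `Λ/λ²`. -/
theorem conjugate_matrix_elliptic (A : Fin 2 → Fin 2 → ℝ) (lam Lam : ℝ)
    (hlam : 0 < lam) (hLam : lam ≤ Lam)
    (hell : ∀ ξ : Fin 2 → ℝ, lam * (ξ 0 ^ 2 + ξ 1 ^ 2) ≤
      (A 0 0 * ξ 0 + A 0 1 * ξ 1) * ξ 0 + (A 1 0 * ξ 0 + A 1 1 * ξ 1) * ξ 1)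
    (hbdd : ∀ ξ η : Fin 2 → ℝ,
      |(A 0 0 * ξ 0 + A 0 1 * ξ 1) * η 0 + (A 1 0 * ξ 0 + A 1 1 * ξ 1) * η 1| ≤
        Lam * Real.sqrt (ξ 0 ^ 2 + ξ 1 ^ 2) * Real.sqrt (η 0 ^ 2 + η 1 ^ 2)) :
    (lam ^ 2 ≤ A 0 0 * A 1 1 - A 0 1 * A 1 0 ∧
      A 0 0 * A 1 1 - A 0 1 * A 1 0 ≤ Lam ^ 2) ∧
    (∀ ξ : Fin 2 → ℝ, lam / Lam ^ 2 * (ξ 0 ^ 2 + ξ 1 ^ 2) ≤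
      ((A 0 0 / (A 0 0 * A 1 1 - A 0 1 * A 1 0)) * ξ 0 +
        (A 1 0 / (A 0 0 * A 1 1 - A 0 1 * A 1 0)) * ξ 1) * ξ 0 +
      ((A 0 1 / (A 0 0 * A 1 1 - A 0 1 * A 1 0)) * ξ 0 +
        (A 1 1 / (A 0 0 * A 1 1 - A 0 1 * A 1 0)) * ξ 1) * ξ 1) ∧
    (∀ ξ η : Fin 2 → ℝ,
      |((A 0 0 / (A 0 0 * A 1 1 - A 0 1 * A 1 0)) * ξ 0 +
          (A 1 0 / (A 0 0 * A 1 1 - A 0 1 * A 1 0)) * ξ 1) * η 0 +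
        ((A 0 1 / (A 0 0 * A 1 1 - A 0 1 * A 1 0)) * ξ 0 +
          (A 1 1 / (A 0 0 * A 1 1 - A 0 1 * A 1 0)) * ξ 1) * η 1| ≤
        Lam / lam ^ 2 * Real.sqrt (ξ 0 ^ 2 + ξ 1 ^ 2) *
          Real.sqrt (η 0 ^ 2 + η 1 ^ 2)) := by
  have hL : 0 < Lam := lt_of_lt_of_le hlam hLam
  have ha := hell ![1, 0]
  have hd := hell ![0, 1]
  have hc1 := hbdd ![1, 0] ![A 0 0, A 1 0]
  have hc2 := hbdd ![0, 1] ![A 0 1, A 1 1]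
  have hdisc : discrim (A 0 0 - lam) (A 0 1 + A 1 0) (A 1 1 - lam) ≤ 0 := by
    apply discrim_le_zero
    intro x
    have h := hell ![x, 1]
    simp at h
    nlinarith
  unfold discrim at hdisc
  simp at ha hd hc1 hc2
  have key : ∀ s t : ℝ, |s * s + t * t| ≤ Lam * Real.sqrt (s ^ 2 + t ^ 2) →
      s ^ 2 + t ^ 2 ≤ Lam ^ 2 := by
    intro s t h
    have h1 := le_trans (le_abs_self _) h
    have h2 := Real.sq_sqrt (show 0 ≤ s ^ 2 + t ^ 2 by positivity)
    have h3 := Real.sqrt_nonneg (s ^ 2 + t ^ 2)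
    nlinarith [sq_nonneg (Lam - Real.sqrt (s ^ 2 + t ^ 2))]
  have k1 := key _ _ hc1
  have k2 := key _ _ hc2
  have hlow : lam ^ 2 ≤ A 0 0 * A 1 1 - A 0 1 * A 1 0 := by
    nlinarith [sq_nonneg (A 0 1 - A 1 0)]
  have hup : A 0 0 * A 1 1 - A 0 1 * A 1 0 ≤ Lam ^ 2 := by
    nlinarith [sq_nonneg (A 0 0 - A 1 1), sq_nonneg (A 0 1 + A 1 0)]
  refine ⟨⟨hlow, hup⟩, ?_⟩
  generalize A 0 0 * A 1 1 - A 0 1 * A 1 0 = D at hlow hup ⊢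
  have hl2 : 0 < lam ^ 2 := by positivity
  have hD : 0 < D := lt_of_lt_of_le hl2 hlow
  constructor
  · intro ξ
    have e : (A 0 0 / D * ξ 0 + A 1 0 / D * ξ 1) * ξ 0 +
        (A 0 1 / D * ξ 0 + A 1 1 / D * ξ 1) * ξ 1 =
        ((A 0 0 * ξ 0 + A 0 1 * ξ 1) * ξ 0 + (A 1 0 * ξ 0 + A 1 1 * ξ 1) * ξ 1) / D := by
      ring
    rw [e]
    calc lam / Lam ^ 2 * (ξ 0 ^ 2 + ξ 1 ^ 2) ≤ lam / D * (ξ 0 ^ 2 + ξ 1 ^ 2) := by gcongr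
      _ = lam * (ξ 0 ^ 2 + ξ 1 ^ 2) / D := by ring
      _ ≤ _ := by gcongr; exact hell ξ
  · intro ξ η
    have e : (A 0 0 / D * ξ 0 + A 1 0 / D * ξ 1) * η 0 +
        (A 0 1 / D * ξ 0 + A 1 1 / D * ξ 1) * η 1 =
        ((A 0 0 * η 0 + A 0 1 * η 1) * ξ 0 + (A 1 0 * η 0 + A 1 1 * η 1) * ξ 1) / D := by
      ring
    rw [e, abs_div, abs_of_pos hD]
    calc _ ≤ Lam * Real.sqrt (η 0 ^ 2 + η 1 ^ 2) * Real.sqrt (ξ 0 ^ 2 + ξ 1 ^ 2) / D := by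
          gcongr; exact hbdd η ξ
      _ = Lam / D * Real.sqrt (ξ 0 ^ 2 + ξ 1 ^ 2) * Real.sqrt (η 0 ^ 2 + η 1 ^ 2) := by ring
      _ ≤ _ := by gcongr

end
end
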